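/- arXiv:2006.04177 — 2 statements merged into one kernel-verified Lean document; each statement's English description precedes it below -/
import Mathlib

section
/- The sumset U₀ + U + U equals ℕ \ {0, 1, 2, 3, 5, 8, 13}; that is, a natural number n can be written as n = a + b + c with a ∈ U₀ and b, c ∈ U if and only if n ∉ {0, 1, 2, 3, 5, 8, 13}. -/
noncomputable def phi : ℝ := (1 + Real.sqrt 5) / 2

/-- The lower Wythoff set `L = {⌊i·φ⌋ : i ≥ 1}`. -/
def lowerWythoff : Set ℕ := {n | ∃ i : ℕ, 1 ≤ i ∧ n = ⌊(i : ℝ) * phi⌋₊}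

/-- The upper Wythoff set `U = {⌊i·φ²⌋ : i ≥ 1}`. -/
def upperWythoff : Set ℕ := {n | ∃ i : ℕ, 1 ≤ i ∧ n = ⌊(i : ℝ) * phi ^ 2⌋₊}

theorem phi_bounds : 1.618 < phi ∧ phi < 1.6181 := by
  have h5 : Real.sqrt 5 ^ 2 = 5 := Real.sq_sqrt (by norm_num)
  have h0 := Real.sqrt_nonneg 5
  unfold phi
  constructor <;> nlinarith

theorem phi_sq : phi ^ 2 = phi + 1 := by
  have h5 : Real.sqrt 5 ^ 2 = 5 := Real.sq_sqrt (by norm_num)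
  unfold phi
  linarith

/-- A positive integer `m` is upper Wythoff as soon as the fractional part of `m φ` is less
than `2 - φ = φ⁻²`. -/
theorem mem_upperWythoff_of_fract_lt {m : ℕ} (hm : 1 ≤ m) (k : ℤ)
    (h0 : 0 ≤ m * phi - k) (h1 : m * phi - k < 2 - phi) : m ∈ upperWythoff := by
  obtain ⟨hl, hu⟩ := phi_bounds
  have hm' : (1 : ℝ) ≤ m := by exact_mod_cast hm
  have hpos : (0 : ℝ) < ((2 * m - k : ℤ) : ℝ) := by
    push_cast
    nlinarith
  have hpos' : 0 < 2 * (m : ℤ) - k := by exact_mod_cast hpos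
  obtain ⟨i, hi⟩ := Int.eq_ofNat_of_zero_le hpos'.le
  refine ⟨i, by omega, ?_⟩
  have hi' : (i : ℝ) = 2 * m - k := by exact_mod_cast hi.symm
  have hinv : (2 - phi) * phi ^ 2 = 1 := by
    linear_combination (1 - phi) * phi_sq
  have key : (i : ℝ) * phi ^ 2 = m + (m * phi - k) * phi ^ 2 := by
    rw [hi']
    linear_combination (m : ℝ) * hinv
  have hsq : 0 < phi ^ 2 := by positivity
  symm
  rw [Nat.floor_eq_iff (by positivity), key]
  constructor
  · have := mul_nonneg h0 hsq.le
    linarith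
  · have := mul_lt_mul_of_pos_right h1 hsq
    linarith

theorem upperWythoff_le_thirteen {m : ℕ} (hm : m ∈ upperWythoff) (h : m ≤ 13) :
    m = 2 ∨ m = 5 ∨ m = 7 ∨ m = 10 ∨ m = 13 := by
  obtain ⟨i, hi, he⟩ := hm
  obtain ⟨hl, hu⟩ := phi_bounds
  rw [phi_sq] at he
  have hnn : 0 ≤ (i : ℝ) * (phi + 1) := by positivity
  obtain ⟨h1, h2⟩ := (Nat.floor_eq_iff hnn).1 he.symm
  have hm' : (m : ℝ) ≤ 13 := by exact_mod_cast h
  have hi6 : i < 6 := by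
    by_contra! hc
    have : (6 : ℝ) ≤ i := by exact_mod_cast hc
    nlinarith
  interval_cases i <;> interval_cases m <;> norm_num at h1 h2 ⊢ <;> linarith

theorem upperWythoff_small :
    2 ∈ upperWythoff ∧ 5 ∈ upperWythoff ∧ 7 ∈ upperWythoff ∧ 10 ∈ upperWythoff ∧
      13 ∈ upperWythoff := by
  obtain ⟨hl, hu⟩ := phi_bounds
  refine ⟨mem_upperWythoff_of_fract_lt (by norm_num) 3 ?_ ?_,
    mem_upperWythoff_of_fract_lt (by norm_num) 8 ?_ ?_,
    mem_upperWythoff_of_fract_lt (by norm_num) 11 ?_ ?_,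
    mem_upperWythoff_of_fract_lt (by norm_num) 16 ?_ ?_,
    mem_upperWythoff_of_fract_lt (by norm_num) 21 ?_ ?_⟩ <;> push_cast <;> linarith

/-- The translates of `[0, φ⁻²)` by `7 φ`, `13 φ` and `14 φ` cover the circle. -/
theorem sub_mem_upperWythoff {n : ℕ} (hn : 15 ≤ n) :
    n - 7 ∈ upperWythoff ∨ n - 13 ∈ upperWythoff ∨ n - 14 ∈ upperWythoff := by
  obtain ⟨hl, hu⟩ := phi_bounds
  have hf0 := Int.floor_le ((n : ℝ) * phi)
  have hf1 := Int.lt_floor_add_one ((n : ℝ) * phi)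
  set k := ⌊(n : ℝ) * phi⌋
  have translate {d : ℕ} (hd : d < n) (j : ℤ) (h0 : 0 ≤ n * phi - k - (d * phi - j))
      (h1 : n * phi - k - (d * phi - j) < 2 - phi) : n - d ∈ upperWythoff := by
    apply mem_upperWythoff_of_fract_lt (by omega) (k - j) <;>
      rw [Nat.cast_sub hd.le] <;> push_cast <;> linarith
  rcases lt_or_ge (n * phi - k) (13 * phi - 21) with h | h
  · exact .inr (.inr (translate (by omega) 23 (by push_cast; linarith) (by push_cast; linarith)))
  rcases lt_or_ge (n * phi - k) (12 * phi - 19) with h | h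
  · exact .inr (.inl (translate (by omega) 21 (by push_cast; linarith) (by push_cast; linarith)))
  rcases lt_or_ge (n * phi - k) (6 * phi - 9) with h | h
  · exact .inl (translate (by omega) 11 (by push_cast; linarith) (by push_cast; linarith))
  · exact .inr (.inr (translate (by omega) 22 (by push_cast; linarith) (by push_cast; linarith)))

/-- Theorem 3.8(ii): `U₀ + U + U = ℕ \ {0, 1, 2, 3, 5, 8, 13}`. -/
theorem upper0_add_upper_add_upper (n : ℕ) :
    (∃ a ∈ upperWythoff ∪ {0}, ∃ b ∈ upperWythoff, ∃ c ∈ upperWythoff, n = a + b + c) ↔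
      n ∉ ({0, 1, 2, 3, 5, 8, 13} : Set ℕ) := by
  simp only [Set.mem_insert_iff, Set.mem_singleton_iff]
  constructor
  · rintro ⟨a, ha, b, hb, c, hc, rfl⟩ hn
    have ha' : a = 0 ∨ a = 2 ∨ a = 5 ∨ a = 7 ∨ a = 10 ∨ a = 13 := by
      rcases ha with ha | ha
      · exact .inr (upperWythoff_le_thirteen ha (by omega))
      · exact .inl ha
    have hb' := upperWythoff_le_thirteen hb (by omega)
    have hc' := upperWythoff_le_thirteen hc (by omega)
    omega
  · intro hn
    obtain ⟨h2, h5, h7, h10, h13⟩ := upperWythoff_small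
    have zero : 0 ∈ upperWythoff ∪ {0} := .inr rfl
    rcases lt_or_ge n 15 with h | h
    · have hcases : n = 4 ∨ n = 6 ∨ n = 7 ∨ n = 9 ∨ n = 10 ∨ n = 11 ∨ n = 12 ∨ n = 14 := by
        omega
      rcases hcases with rfl | rfl | rfl | rfl | rfl | rfl | rfl | rfl
      · exact ⟨0, zero, 2, h2, 2, h2, rfl⟩
      · exact ⟨2, .inl h2, 2, h2, 2, h2, rfl⟩
      · exact ⟨0, zero, 2, h2, 5, h5, rfl⟩
      · exact ⟨0, zero, 2, h2, 7, h7, rfl⟩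
      · exact ⟨0, zero, 5, h5, 5, h5, rfl⟩
      · exact ⟨2, .inl h2, 2, h2, 7, h7, rfl⟩
      · exact ⟨0, zero, 5, h5, 7, h7, rfl⟩
      · exact ⟨0, zero, 7, h7, 7, h7, rfl⟩
    · rcases sub_mem_upperWythoff h with hu | hu | hu
      · exact ⟨2, .inl h2, 5, h5, n - 7, hu, by omega⟩
      · exact ⟨0, zero, 13, h13, n - 13, hu, by omega⟩
      · exact ⟨7, .inl h7, 7, h7, n - 14, hu, by omega⟩
end

section
/- For every integer n ≥ 2, the number of ordered pairs (i, j) of positive integers such that ⌊i·φ⌋ + ⌊j·φ⌋ = F_n − 1 equals F_{n−1} − 1. -/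
theorem phi_eq_goldenRatio : phi = Real.goldenRatio := rfl

theorem fib_mul_abs_fib_succ_sub_lt_one (m : ℕ) :
    (Nat.fib m : ℝ) * |(Nat.fib (m + 1) : ℝ) - Nat.fib m * phi| < 1 := by
  have hconj : (Nat.fib (m + 1) : ℝ) - Nat.fib m * phi = Real.goldenConj ^ m := by
    rw [phi_eq_goldenRatio, mul_comm, Real.fib_succ_sub_goldenRatio_mul_fib]
  have hfib : (Nat.fib m : ℝ) < Real.goldenRatio ^ m := by
    have h := Real.fib_succ_sub_goldenConj_mul_fib m
    rcases Nat.eq_zero_or_pos m with rfl | hm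
    · simp
    · have h1 : (Nat.fib m : ℝ) ≤ Nat.fib (m + 1) := by exact_mod_cast Nat.fib_le_fib_succ
      have h2 : (0 : ℝ) < Nat.fib m := by exact_mod_cast Nat.fib_pos.mpr hm
      nlinarith [Real.goldenConj_neg]
  rw [hconj, abs_pow]
  have hinv : Real.goldenRatio * |Real.goldenConj| = 1 := by
    rw [abs_of_neg Real.goldenConj_neg, mul_neg, Real.goldenRatio_mul_goldenConj, neg_neg]
  calc (Nat.fib m : ℝ) * |Real.goldenConj| ^ m
      < Real.goldenRatio ^ m * |Real.goldenConj| ^ m := by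
        have := Real.goldenConj_ne_zero
        gcongr
    _ = 1 := by rw [← mul_pow, hinv, one_pow]

theorem not_fib_dvd_mul_fib_succ {m i : ℕ} (hi : 1 ≤ i) (him : i < Nat.fib m) :
    ¬ Nat.fib m ∣ i * Nat.fib (m + 1) := fun h =>
  absurd (Nat.le_of_dvd hi ((Nat.fib_coprime_fib_succ m).dvd_of_dvd_mul_right h)) (by omega)

/-- Below `F_m`, the lower Wythoff sequence agrees with the multiples of the convergent
`F_{m+1} / F_m` rounded down. -/
theorem floor_mul_phi_eq_div {m i : ℕ} (hi : 1 ≤ i) (him : i < Nat.fib m) :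
    ⌊(i : ℝ) * phi⌋₊ = i * Nat.fib (m + 1) / Nat.fib m := by
  have hF : 0 < Nat.fib m := by omega
  have hFr : (0 : ℝ) < Nat.fib m := by exact_mod_cast hF
  have hr0 : 0 < i * Nat.fib (m + 1) % Nat.fib m :=
    Nat.pos_of_ne_zero fun h => not_fib_dvd_mul_fib_succ hi him (Nat.dvd_of_mod_eq_zero h)
  have hrF : i * Nat.fib (m + 1) % Nat.fib m < Nat.fib m := Nat.mod_lt _ hF
  have hdiv := Nat.div_add_mod (i * Nat.fib (m + 1)) (Nat.fib m)
  generalize i * Nat.fib (m + 1) / Nat.fib m = q at *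
  generalize i * Nat.fib (m + 1) % Nat.fib m = r at *
  have hr0' : (1 : ℝ) ≤ r := by exact_mod_cast hr0
  have hrF' : (r : ℝ) + 1 ≤ Nat.fib m := by exact_mod_cast hrF
  have hdiv' : (Nat.fib m : ℝ) * q + r = i * Nat.fib (m + 1) := by exact_mod_cast hdiv
  have hphi : 0 < phi := Real.goldenRatio_pos
  have herr : |(i : ℝ) * (Nat.fib (m + 1) - Nat.fib m * phi)| < 1 := by
    rw [abs_mul, Nat.abs_cast]
    refine lt_of_le_of_lt ?_ (fib_mul_abs_fib_succ_sub_lt_one m)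
    gcongr
  obtain ⟨h1, h2⟩ := abs_lt.mp herr
  rw [Nat.floor_eq_iff (by positivity)]
  constructor
  · refine le_of_mul_le_mul_left ?_ hFr
    linarith
  · refine lt_of_mul_lt_mul_left ?_ hFr.le
    linarith

theorem floor_mul_phi_add_floor_mul_phi {m i j : ℕ} (hi : 1 ≤ i) (hj : 1 ≤ j)
    (hij : i + j = Nat.fib m) :
    ⌊(i : ℝ) * phi⌋₊ + ⌊(j : ℝ) * phi⌋₊ = Nat.fib (m + 1) - 1 := by
  rw [floor_mul_phi_eq_div (m := m) hi (by omega), floor_mul_phi_eq_div (m := m) hj (by omega)]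
  have hF : 0 < Nat.fib m := by omega
  have hsum : i * Nat.fib (m + 1) + j * Nat.fib (m + 1) = Nat.fib (m + 1) * Nat.fib m := by
    rw [← hij]; ring
  have hcarry : Nat.fib m ≤ i * Nat.fib (m + 1) % Nat.fib m + j * Nat.fib (m + 1) % Nat.fib m := by
    have hdvd : Nat.fib m ∣
        i * Nat.fib (m + 1) % Nat.fib m + j * Nat.fib (m + 1) % Nat.fib m := by
      rw [Nat.dvd_iff_mod_eq_zero, ← Nat.add_mod, hsum, Nat.mul_mod_left]
    refine Nat.le_of_dvd (Nat.add_pos_left (Nat.pos_of_ne_zero fun h => ?_) _) hdvd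
    exact not_fib_dvd_mul_fib_succ hi (by omega) (Nat.dvd_of_mod_eq_zero h)
  have h := Nat.add_div_eq_of_le_mod_add_mod hcarry hF
  rw [hsum, Nat.mul_div_left _ hF] at h
  exact Nat.eq_sub_of_add_eq h.symm

theorem strictMono_floor_mul_phi : StrictMono fun i : ℕ => ⌊(i : ℝ) * phi⌋₊ := by
  refine strictMono_nat_of_lt_succ fun i => ?_
  have hphi : 1 < phi := Real.one_lt_goldenRatio
  have hle : (⌊(i : ℝ) * phi⌋₊ : ℝ) ≤ i * phi := Nat.floor_le (by positivity)
  refine Nat.le_floor ?_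
  push_cast
  linarith

/-- A representation of `F_{m+1} - 1` as a sum of two lower Wythoff numbers has indices summing
to `F_m`. -/
theorem floor_mul_phi_add_eq_iff {m i j : ℕ} (hi : 1 ≤ i) (hj : 1 ≤ j) :
    ⌊(i : ℝ) * phi⌋₊ + ⌊(j : ℝ) * phi⌋₊ = Nat.fib (m + 1) - 1 ↔ i + j = Nat.fib m := by
  refine ⟨fun h => ?_, floor_mul_phi_add_floor_mul_phi hi hj⟩
  have hmono := strictMono_floor_mul_phi
  rcases lt_or_ge i (Nat.fib m) with him | him
  · have h' := floor_mul_phi_add_floor_mul_phi hi (j := Nat.fib m - i) (m := m)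
      (by omega) (by omega)
    have : j = Nat.fib m - i := hmono.injective (by omega)
    omega
  · exfalso
    have h1 : ⌊((Nat.fib m : ℕ) : ℝ) * phi⌋₊ ≤ ⌊(i : ℝ) * phi⌋₊ := hmono.monotone him
    have h2 : ⌊((0 : ℕ) : ℝ) * phi⌋₊ < ⌊(j : ℝ) * phi⌋₊ := hmono hj
    have h3 : Nat.fib (m + 1) - 1 ≤ ⌊((Nat.fib m : ℕ) : ℝ) * phi⌋₊ := by
      rcases Nat.eq_zero_or_pos m with rfl | hm
      · simp
      have hF : (1 : ℝ) ≤ Nat.fib m := by exact_mod_cast Nat.fib_pos.mpr hm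
      have herr := fib_mul_abs_fib_succ_sub_lt_one m
      have hle := le_abs_self ((Nat.fib (m + 1) : ℝ) - Nat.fib m * phi)
      have hpos := abs_nonneg ((Nat.fib (m + 1) : ℝ) - Nat.fib m * phi)
      refine Nat.le_floor ?_
      rw [Nat.cast_sub (Nat.fib_pos.mpr m.succ_pos)]
      push_cast
      nlinarith
    omega

theorem ncard_pos_pairs_add_eq (N : ℕ) :
    {p : ℕ × ℕ | 1 ≤ p.1 ∧ 1 ≤ p.2 ∧ p.1 + p.2 = N}.ncard = N - 1 := by
  have : {p : ℕ × ℕ | 1 ≤ p.1 ∧ 1 ≤ p.2 ∧ p.1 + p.2 = N} =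
      (fun i => (i, N - i)) '' (Finset.Ico 1 N : Set ℕ) := by
    ext ⟨i, j⟩
    simp only [Set.mem_ofPred_eq, Finset.coe_Ico, Set.mem_image, Set.mem_Ico, Prod.mk.injEq]
    constructor
    · rintro ⟨h1, h2, h3⟩
      exact ⟨i, by omega, rfl, by omega⟩
    · rintro ⟨k, hk, rfl, rfl⟩
      omega
  rw [this, Set.ncard_image_of_injective _ fun a b h => congrArg Prod.fst h,
    Set.ncard_coe_finset, Nat.card_Ico]

/-- The number of ordered pairs `(i, j)` of positive integers with
`⌊i·φ⌋ + ⌊j·φ⌋ = F_n - 1` equals `F_{n-1} - 1`, for `n ≥ 2`. -/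
theorem card_reps_fib_sub_one (n : ℕ) (hn : 2 ≤ n) :
    {p : ℕ × ℕ | 1 ≤ p.1 ∧ 1 ≤ p.2 ∧
      ⌊(p.1 : ℝ) * phi⌋₊ + ⌊(p.2 : ℝ) * phi⌋₊ = Nat.fib n - 1}.ncard
      = Nat.fib (n - 1) - 1 := by
  obtain ⟨m, rfl⟩ : ∃ m, n = m + 1 := ⟨n - 1, by omega⟩
  rw [Nat.add_sub_cancel, ← ncard_pos_pairs_add_eq (Nat.fib m)]
  refine congrArg Set.ncard (Set.ext fun p => ?_)
  exact and_congr_right fun hi => and_congr_right fun hj => floor_mul_phi_add_eq_iff hi hj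
end
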